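/- Let n, m ≥ 1 and let h ∈ ℝ^{n×m} be a fixed matrix with covariance Φ = (1/n)·hᵀh. Let W be a random n×n matrix with i.i.d. Gaussian N(0, 1/n) entries, and set h' = W·h with covariance Φ' = (1/n)·h'ᵀh'. Then for all indices α, β, γ, δ: E[Φ'_{αβ}·Φ'_{γδ}] − Φ_{αβ}·Φ_{γδ} = (1/n)·( Φ_{αγ}·Φ_{βδ} + Φ_{αδ}·Φ_{βγ} ). Equivalently, the conditional covariance of the one-step linear-network covariance update equals (1/n)·Σ^v(Φ)^{αβ,γδ}, where Σ^v(Φ)^{αβ,γδ} = Φ_{αγ}·Φ_{βδ} + Φ_{αδ}·Φ_{βγ}. -/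

import Mathlib

open MeasureTheory ProbabilityTheory Matrix
open scoped NNReal

theorem deriv_mul_exp_mul_sq_div_two (v : ℝ) {p p' : ℝ → ℝ}
    (hp : ∀ t, HasDerivAt p (p' t) t) :
    deriv (fun t => p t * Real.exp (v * t ^ 2 / 2)) =
      fun t => (p' t + v * t * p t) * Real.exp (v * t ^ 2 / 2) := by
  ext t
  have he : HasDerivAt (fun t : ℝ => Real.exp (v * t ^ 2 / 2))
      (Real.exp (v * t ^ 2 / 2) * (v * t)) t := by
    refine HasDerivAt.exp ?_
    refine (((hasDerivAt_pow 2 t).const_mul v).div_const 2).congr_deriv ?_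
    norm_num
    ring
  rw [((hp t).fun_mul he).deriv]
  ring

theorem integral_pow_gaussianReal_eq_iteratedDeriv (v : ℝ≥0) (k : ℕ) :
    ∫ x, x ^ k ∂gaussianReal 0 v =
      iteratedDeriv k (fun t : ℝ => Real.exp (v * t ^ 2 / 2)) 0 := by
  have h := iteratedDeriv_mgf_zero (X := id) (μ := gaussianReal 0 v)
    (by simp [integrableExpSet_id_gaussianReal]) k
  rw [mgf_id_gaussianReal] at h
  simpa using h.symm

theorem moments_gaussianReal_zero (v : ℝ≥0) :
    ∫ x, x ∂gaussianReal 0 v = 0 ∧ ∫ x, x ^ 2 ∂gaussianReal 0 v = v ∧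
      ∫ x, x ^ 3 ∂gaussianReal 0 v = 0 ∧ ∫ x, x ^ 4 ∂gaussianReal 0 v = 3 * (v : ℝ) ^ 2 := by
  have d1 : deriv (fun t => Real.exp (v * t ^ 2 / 2)) =
      fun t => (v * t) * Real.exp (v * t ^ 2 / 2) := by
    simpa using deriv_mul_exp_mul_sq_div_two v (fun t => hasDerivAt_const t (1 : ℝ))
  have d2 := deriv_mul_exp_mul_sq_div_two v (fun t => hasDerivAt_const_mul (x := t) (v : ℝ))
  have d3 := deriv_mul_exp_mul_sq_div_two v (p := fun t => v + v * t * (v * t))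
    (p' := fun t => 2 * v ^ 2 * t) (fun t => by
      rw [show (fun t : ℝ => v + v * t * (v * t)) = fun t => v + (v : ℝ) ^ 2 * t ^ 2 by
        ext t; ring]
      refine (((hasDerivAt_pow 2 t).const_mul ((v : ℝ) ^ 2)).const_add (v : ℝ)).congr_deriv ?_
      norm_num
      ring)
  have d4 := deriv_mul_exp_mul_sq_div_two v
    (p := fun t => 2 * v ^ 2 * t + v * t * (v + v * t * (v * t)))
    (p' := fun t => 3 * v ^ 2 + 3 * v ^ 3 * t ^ 2) (fun t => by
      rw [show (fun t : ℝ => 2 * v ^ 2 * t + v * t * (v + v * t * (v * t))) =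
        fun t => 3 * (v : ℝ) ^ 2 * t + (v : ℝ) ^ 3 * t ^ 3 by ext t; ring]
      refine ((hasDerivAt_const_mul (x := t) (3 * (v : ℝ) ^ 2)).fun_add
        ((hasDerivAt_pow 3 t).const_mul ((v : ℝ) ^ 3))).congr_deriv ?_
      norm_num
      ring)
  refine ⟨integral_id_gaussianReal, ?_, ?_, ?_⟩ <;>
    rw [integral_pow_gaussianReal_eq_iteratedDeriv] <;>
    simp [iteratedDeriv_succ, iteratedDeriv_zero, d1, d2, d3, d4]

theorem integrable_pow_gaussianReal (μ : ℝ) (v : ℝ≥0) (k : ℕ) :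
    Integrable (fun x => x ^ k) (gaussianReal μ v) := by
  have h := (memLp_id_gaussianReal' (μ := μ) (v := v) k (by simp)).integrable_norm_pow'
  refine h.mono' (by fun_prop) (Filter.Eventually.of_forall fun x => ?_)
  simp

section Pi

variable {ι : Type*} [Fintype ι] [DecidableEq ι]

theorem mul_four_eq_prod_pow (W : ι → ℝ) (a b c d : ι) :
    W a * W b * W c * W d = ∏ i, W i ^ ((if i = a then 1 else 0) + (if i = b then 1 else 0) +
      (if i = c then 1 else 0) + (if i = d then 1 else 0)) := by
  have h : ∀ a, ∏ i, W i ^ (if i = a then 1 else 0) = W a := fun a => by simp [pow_ite]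
  simp only [pow_add, Finset.prod_mul_distrib, h]

theorem integrable_mul_four_pi_gaussianReal (v : ℝ≥0) (a b c d : ι) :
    Integrable (fun W : ι → ℝ => W a * W b * W c * W d)
      (Measure.pi fun _ : ι => gaussianReal 0 v) := by
  simp_rw [mul_four_eq_prod_pow]
  exact Integrable.fintype_prod (f := fun i (x : ℝ) => x ^ ((if i = a then 1 else 0) +
      (if i = b then 1 else 0) + (if i = c then 1 else 0) + (if i = d then 1 else 0)))
    fun i => integrable_pow_gaussianReal 0 v _

theorem prod_multiplicity_four (M : ℕ → ℝ) (v : ℝ) (h0 : M 0 = 1) (h1 : M 1 = 0) (h2 : M 2 = v)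
    (h3 : M 3 = 0) (h4 : M 4 = 3 * v ^ 2) (a b c d : ι) :
    ∏ i, M ((if i = a then 1 else 0) + (if i = b then 1 else 0) +
      (if i = c then 1 else 0) + (if i = d then 1 else 0)) =
      v ^ 2 * ((if a = b then 1 else 0) * (if c = d then 1 else 0) +
        (if a = c then 1 else 0) * (if b = d then 1 else 0) +
        (if a = d then 1 else 0) * (if b = c then 1 else 0)) := by
  rw [← Finset.prod_subset (Finset.subset_univ {a, b, c, d}) (by
      intro i _ hi
      simp only [Finset.mem_insert, Finset.mem_singleton, not_or] at hi
      simp [hi, h0])]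
  have hba : b = a ↔ a = b := eq_comm
  have hca : c = a ↔ a = c := eq_comm
  have hda : d = a ↔ a = d := eq_comm
  have hcb : c = b ↔ b = c := eq_comm
  have hdb : d = b ↔ b = d := eq_comm
  have hdc : d = c ↔ c = d := eq_comm
  by_cases hab : a = b <;> by_cases hac : a = c <;> by_cases had : a = d <;>
    by_cases hbc : b = c <;> by_cases hbd : b = d <;> by_cases hcd : c = d <;>
    (try subst_vars) <;> first
      | contradiction
      | (simp [*] <;> ring)

theorem integral_mul_four_pi_gaussianReal (v : ℝ≥0) (a b c d : ι) :
    ∫ W : ι → ℝ, W a * W b * W c * W d ∂(Measure.pi fun _ : ι => gaussianReal 0 v) =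
      (v : ℝ) ^ 2 * ((if a = b then 1 else 0) * (if c = d then 1 else 0) +
        (if a = c then 1 else 0) * (if b = d then 1 else 0) +
        (if a = d then 1 else 0) * (if b = c then 1 else 0)) := by
  obtain ⟨m1, m2, m3, m4⟩ := moments_gaussianReal_zero v
  simp_rw [mul_four_eq_prod_pow]
  rw [integral_fintype_prod_eq_prod (fun i (x : ℝ) => x ^ ((if i = a then 1 else 0) +
      (if i = b then 1 else 0) + (if i = c then 1 else 0) + (if i = d then 1 else 0)))]
  exact prod_multiplicity_four (fun k => ∫ x, x ^ k ∂gaussianReal 0 v) v (by simp) (by simp [m1])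
    m2 m3 m4 a b c d

end Pi

theorem integral_mul_four_linear_rows {n : ℕ} {κ : Type*} (v : ℝ≥0)
    (h : Matrix (Fin n) κ ℝ) (α β γ δ : κ) (k l : Fin n) :
    Integrable (fun W : Fin n × Fin n → ℝ => (∑ p, W (k, p) * h p α) * (∑ p, W (k, p) * h p β) *
        ((∑ p, W (l, p) * h p γ) * (∑ p, W (l, p) * h p δ)))
        (Measure.pi fun _ : Fin n × Fin n => gaussianReal 0 v) ∧
    ∫ W : Fin n × Fin n → ℝ, (∑ p, W (k, p) * h p α) * (∑ p, W (k, p) * h p β) *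
        ((∑ p, W (l, p) * h p γ) * (∑ p, W (l, p) * h p δ))
        ∂(Measure.pi fun _ : Fin n × Fin n => gaussianReal 0 v) =
      (v : ℝ) ^ 2 * ((hᵀ * h) α β * (hᵀ * h) γ δ + (if k = l then 1 else 0) *
        ((hᵀ * h) α γ * (hᵀ * h) β δ + (hᵀ * h) α δ * (hᵀ * h) β γ)) := by
  have sum_mul_four : ∀ A B C D : Fin n → ℝ,
      (∑ p, A p) * (∑ p, B p) * ((∑ p, C p) * (∑ p, D p)) =
        ∑ p, ∑ q, ∑ r, ∑ s, A p * B q * (C r * D s) := by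
    intro A B C D
    rw [Finset.sum_mul_sum, Finset.sum_mul_sum, Finset.sum_mul]
    refine Finset.sum_congr rfl fun p _ => ?_
    rw [Finset.sum_mul]
    refine Finset.sum_congr rfl fun q _ => ?_
    rw [Finset.mul_sum]
    refine Finset.sum_congr rfl fun r _ => ?_
    rw [Finset.mul_sum]
  have expand : ∀ W : Fin n × Fin n → ℝ,
      (∑ p, W (k, p) * h p α) * (∑ p, W (k, p) * h p β) *
        ((∑ p, W (l, p) * h p γ) * (∑ p, W (l, p) * h p δ)) =
      ∑ p, ∑ q, ∑ r, ∑ s, (h p α * h q β * (h r γ * h s δ)) *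
        (W (k, p) * W (k, q) * W (l, r) * W (l, s)) := by
    intro W
    rw [sum_mul_four]
    refine Finset.sum_congr rfl fun p _ => Finset.sum_congr rfl fun q _ =>
      Finset.sum_congr rfl fun r _ => Finset.sum_congr rfl fun s _ => ?_
    ring
  have hint : ∀ p q r s : Fin n, Integrable (fun W : Fin n × Fin n → ℝ =>
      (h p α * h q β * (h r γ * h s δ)) * (W (k, p) * W (k, q) * W (l, r) * W (l, s)))
      (Measure.pi fun _ : Fin n × Fin n => gaussianReal 0 v) := fun p q r s =>
    (integrable_mul_four_pi_gaussianReal v _ _ _ _).const_mul _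
  have hint1 := fun p q r => integrable_finsetSum Finset.univ fun s _ => hint p q r s
  have hint2 := fun p q => integrable_finsetSum Finset.univ fun r _ => hint1 p q r
  have hint3 := fun p => integrable_finsetSum Finset.univ fun q _ => hint2 p q
  simp_rw [expand]
  refine ⟨integrable_finsetSum Finset.univ fun p _ => hint3 p, ?_⟩
  rw [integral_finsetSum _ fun p _ => hint3 p]
  simp_rw [integral_finsetSum _ fun q _ => hint2 _ q, integral_finsetSum _ fun r _ => hint1 _ _ r,
    integral_finsetSum _ fun s _ => hint _ _ _ s, integral_const_mul,
    integral_mul_four_pi_gaussianReal]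
  simp only [Matrix.mul_apply, Matrix.transpose_apply]
  have collapse_pq : ∀ F : Fin n → Fin n → Fin n → Fin n → ℝ, (∑ p, ∑ q, ∑ r, ∑ s,
      F p q r s * ((if p = q then 1 else 0) * (if r = s then 1 else 0))) =
        ∑ p, ∑ r, F p p r r := fun F => by simp
  have collapse_pr : ∀ F : Fin n → Fin n → Fin n → Fin n → ℝ, (∑ p, ∑ q, ∑ r, ∑ s,
      F p q r s * ((if p = r then 1 else 0) * (if q = s then 1 else 0))) =
        ∑ p, ∑ q, F p q p q := fun F => by simp
  have collapse_ps : ∀ F : Fin n → Fin n → Fin n → Fin n → ℝ, (∑ p, ∑ q, ∑ r, ∑ s,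
      F p q r s * ((if p = s then 1 else 0) * (if q = r then 1 else 0))) =
        ∑ p, ∑ q, F p q q p := fun F => by simp
  set F : Fin n → Fin n → Fin n → Fin n → ℝ := fun p q r s => h p α * h q β * (h r γ * h s δ)
    with hF
  have split : ∀ p q r s : Fin n, h p α * h q β * (h r γ * h s δ) * ((v : ℝ) ^ 2 *
      ((if (k, p) = (k, q) then 1 else 0) * (if (l, r) = (l, s) then 1 else 0) +
        (if (k, p) = (l, r) then 1 else 0) * (if (k, q) = (l, s) then 1 else 0) +
        (if (k, p) = (l, s) then 1 else 0) * (if (k, q) = (l, r) then 1 else 0))) =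
      (v : ℝ) ^ 2 * (F p q r s * ((if p = q then 1 else 0) * (if r = s then 1 else 0)) +
        (if k = l then 1 else 0) *
          (F p q r s * ((if p = r then 1 else 0) * (if q = s then 1 else 0)) +
            F p q r s * ((if p = s then 1 else 0) * (if q = r then 1 else 0)))) := by
    intro p q r s
    by_cases hkl : k = l
    · simp only [hkl, Prod.mk.injEq, true_and, if_true, hF]
      ring
    · simp only [hkl, Prod.mk.injEq, true_and, false_and, if_false, hF]
      ring
  simp_rw [split, ← Finset.mul_sum, Finset.sum_add_distrib, ← Finset.mul_sum,
    Finset.sum_add_distrib]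
  rw [collapse_pq, collapse_pr, collapse_ps]
  simp_rw [Finset.sum_mul_sum, hF]
  congr! 6 <;> ring

theorem linear_step_covariance_fluctuation (n m : ℕ) (hn : 1 ≤ n) (hm : 1 ≤ m)
    (h : Matrix (Fin n) (Fin m) ℝ) (α β γ δ : Fin m) :
    (∫ W : Fin n × Fin n → ℝ,
        (((n : ℝ)⁻¹ •
            (((Matrix.of fun i j => W (i, j)) * h)ᵀ *
              ((Matrix.of fun i j => W (i, j)) * h))) α β *
          ((n : ℝ)⁻¹ •
            (((Matrix.of fun i j => W (i, j)) * h)ᵀ *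
              ((Matrix.of fun i j => W (i, j)) * h))) γ δ)
        ∂(Measure.pi fun _ : Fin n × Fin n => gaussianReal 0 (1 / (n : ℝ≥0)))) -
      ((n : ℝ)⁻¹ • (hᵀ * h)) α β * ((n : ℝ)⁻¹ • (hᵀ * h)) γ δ =
    (1 / (n : ℝ)) *
      (((n : ℝ)⁻¹ • (hᵀ * h)) α γ * ((n : ℝ)⁻¹ • (hᵀ * h)) β δ +
        ((n : ℝ)⁻¹ • (hᵀ * h)) α δ * ((n : ℝ)⁻¹ • (hᵀ * h)) β γ) := by
  have expand : ∀ W : Fin n × Fin n → ℝ,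
      ((n : ℝ)⁻¹ • (((Matrix.of fun i j => W (i, j)) * h)ᵀ *
          ((Matrix.of fun i j => W (i, j)) * h))) α β *
        ((n : ℝ)⁻¹ • (((Matrix.of fun i j => W (i, j)) * h)ᵀ *
          ((Matrix.of fun i j => W (i, j)) * h))) γ δ =
      (n : ℝ)⁻¹ ^ 2 * ∑ k, ∑ l, (∑ p, W (k, p) * h p α) * (∑ p, W (k, p) * h p β) *
        ((∑ p, W (l, p) * h p γ) * (∑ p, W (l, p) * h p δ)) := by
    intro W
    rw [← Finset.sum_mul_sum]
    simp only [Matrix.smul_apply, Matrix.mul_apply, Matrix.transpose_apply, Matrix.of_apply,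
      smul_eq_mul]
    ring
  simp_rw [expand]
  rw [integral_const_mul]
  have key := integral_mul_four_linear_rows (1 / (n : ℝ≥0)) h α β γ δ
  rw [integral_finsetSum _ fun k _ => integrable_finsetSum _ fun l _ => (key k l).1]
  simp_rw [integral_finsetSum _ fun l _ => (key _ l).1, (key _ _).2]
  have hn0 : (n : ℝ) ≠ 0 := by positivity
  simp only [Matrix.smul_apply, smul_eq_mul]
  simp [← Finset.mul_sum, Finset.sum_add_distrib]
  field_simp
  ring
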